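/- arXiv:2309.09263 — 2 statements merged into one kernel-verified Lean document; each statement's English description precedes it below -/
import Mathlib

section
/- Let n ∈ {6,7} and λ = (2,1). Then every γ ∈ Q₁ with γ ≻ λ and γ ∉ Γ has the form γ = (n−1)λ + n(−1,k) or γ = (n−2)λ + n(−1,k) for some k ∈ ℕ. -/
/-- The additive submonoid of ℤ² generated by ν₁ = (n,0), ν₂ = (0,n) and λ. -/
def GammaQO (n : ℕ) (lam : ℤ × ℤ) : AddSubmonoid (ℤ × ℤ) :=
  AddSubmonoid.closure {((n : ℤ), 0), (0, (n : ℤ)), lam}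

/-- γ ∈ Q₁ = nℤ² + ℤλ. -/
def memQ1 (n : ℕ) (lam γ : ℤ × ℤ) : Prop :=
  ∃ a c₁ c₂ : ℤ, γ = a • lam + ((n : ℤ) * c₁, (n : ℤ) * c₂)

/-- λ has order n modulo nℤ²: n is the least positive k with kλ ∈ nℤ². -/
def orderModN (n : ℕ) (lam : ℤ × ℤ) : Prop :=
  IsLeast {k : ℕ | 0 < k ∧ ∃ c₁ c₂ : ℤ, (k : ℤ) • lam = ((n : ℤ) * c₁, (n : ℤ) * c₂)} n

/-- γ belongs to Γ ∪ ⋃_{i ∈ {1,2}, λᵢ ≥ n} (Γ + 2λ − νᵢ). -/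
def memBad (n : ℕ) (lam γ : ℤ × ℤ) : Prop :=
  γ ∈ GammaQO n lam ∨
  ((n : ℤ) ≤ lam.1 ∧ ∃ g ∈ GammaQO n lam, γ = g + (2 : ℤ) • lam - ((n : ℤ), 0)) ∨
  ((n : ℤ) ≤ lam.2 ∧ ∃ g ∈ GammaQO n lam, γ = g + (2 : ℤ) • lam - (0, (n : ℤ)))

/-- Natural-number combinations of the three generators lie in the monoid. -/
theorem nsmul_add_mem_GammaQO (n : ℕ) (lam : ℤ × ℤ) (r c₁ c₂ : ℕ) :
    r • lam + ((n : ℤ) * c₁, (n : ℤ) * c₂) ∈ GammaQO n lam := by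
  have h₁ : ((n : ℤ), (0 : ℤ)) ∈ GammaQO n lam := AddSubmonoid.subset_closure (by simp)
  have h₂ : ((0 : ℤ), (n : ℤ)) ∈ GammaQO n lam := AddSubmonoid.subset_closure (by simp)
  have h₃ : lam ∈ GammaQO n lam := AddSubmonoid.subset_closure (by simp)
  have h := add_mem (nsmul_mem h₃ r) (add_mem (nsmul_mem h₁ c₁) (nsmul_mem h₂ c₂))
  convert h using 2
  ext <;> simp [mul_comm]

/-- An element of `Q₁` is a combination whose `lam`-coefficient lies in `[0, n)`. -/
theorem memQ1.exists_reduced {n : ℕ} (hn : 0 < n) {lam γ : ℤ × ℤ} (h : memQ1 n lam γ) :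
    ∃ (r : ℕ) (c₁ c₂ : ℤ), r < n ∧ γ = r • lam + ((n : ℤ) * c₁, (n : ℤ) * c₂) := by
  obtain ⟨a, c₁, c₂, rfl⟩ := h
  have hn' : (0 : ℤ) < n := by exact_mod_cast hn
  have hr := Int.emod_nonneg a hn'.ne'
  have hlt := Int.emod_lt_of_pos a hn'
  have hdiv := Int.emod_add_mul_ediv a n
  generalize a / (n : ℤ) = q at hdiv
  lift a % (n : ℤ) to ℕ using hr with r
  refine ⟨r, c₁ + q * lam.1, c₂ + q * lam.2, by exact_mod_cast hlt, ?_⟩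
  subst hdiv
  ext <;> simp <;> ring

/-- Proposition 4.6(b) core: n ∈ {6,7}, λ = (2,1). -/
theorem stmt8 (n : ℕ) (hn : n = 6 ∨ n = 7) (lam : ℤ × ℤ) (hlam : lam = (2, 1))
    (γ : ℤ × ℤ) (hγQ : memQ1 n lam γ) (hle : lam ≤ γ) (hne : γ ≠ lam)
    (hΓ : γ ∉ GammaQO n lam) :
    ∃ k : ℕ, γ = ((n : ℤ) - 1) • lam + (n : ℤ) • (((-1 : ℤ), (k : ℤ)) : ℤ × ℤ) ∨
             γ = ((n : ℤ) - 2) • lam + (n : ℤ) • (((-1 : ℤ), (k : ℤ)) : ℤ × ℤ) := by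
  subst hlam
  obtain ⟨r, c₁, c₂, hr, rfl⟩ := hγQ.exists_reduced (by omega)
  obtain ⟨h₁, h₂⟩ := Prod.le_def.mp hle
  simp only [nsmul_eq_mul, Prod.fst_add, Prod.snd_add, Prod.fst_mul, Prod.snd_mul,
    Prod.fst_natCast, Prod.snd_natCast] at h₁ h₂
  have hc₂ : 0 ≤ c₂ := by rcases hn with rfl | rfl <;> push_cast at * <;> omega
  lift c₂ to ℕ using hc₂ with k
  have hc₁ : c₁ < 0 := by
    by_contra! hc₁
    lift c₁ to ℕ using hc₁ with l
    exact hΓ (nsmul_add_mem_GammaQO n (2, 1) r l k)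
  obtain rfl : c₁ = -1 := by rcases hn with rfl | rfl <;> push_cast at * <;> omega
  refine ⟨k, ?_⟩
  simp only [Prod.ext_iff, Prod.fst_add, Prod.snd_add, Prod.smul_fst, Prod.smul_snd,
    Prod.fst_mul, Prod.snd_mul, Prod.fst_natCast, Prod.snd_natCast, nsmul_eq_mul, smul_eq_mul]
  rcases hn with rfl | rfl <;> push_cast at * <;> omega
end

section
/- Let (n, λ) be one of (5,(2,2)), (4,(3,2)), (4,(3,3)). Then every γ ∈ Q₁ with γ ≻ λ and γ ∉ Γ has the form γ = (n−1)λ + n(c₁,c₂) with integers c₁ ≥ −1 and c₂ ≥ −1 such that c₁ = −1 or c₂ = −1. -/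
/-- Nonnegative integer combinations of the generators lie in `GammaQO n lam`. -/
theorem smul_add_mem_GammaQO (n : ℕ) (lam : ℤ × ℤ) {a p q : ℤ} (ha : 0 ≤ a) (hp : 0 ≤ p)
    (hq : 0 ≤ q) : a • lam + ((n : ℤ) * p, (n : ℤ) * q) ∈ GammaQO n lam := by
  lift a to ℕ using ha
  lift p to ℕ using hp
  lift q to ℕ using hq
  have h₁ : ((n : ℤ), (0 : ℤ)) ∈ GammaQO n lam := AddSubmonoid.subset_closure (by simp)
  have h₂ : ((0 : ℤ), (n : ℤ)) ∈ GammaQO n lam := AddSubmonoid.subset_closure (by simp)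
  have h₃ : lam ∈ GammaQO n lam := AddSubmonoid.subset_closure (by simp)
  convert add_mem (nsmul_mem h₃ a) (add_mem (nsmul_mem h₁ p) (nsmul_mem h₂ q)) using 1
  ext <;> simp [mul_comm]

/-- Modulo `n`, the coefficient of `lam` can be taken in `[0, n)`. -/
theorem memQ1.exists_coeff_lt {n : ℕ} {lam γ : ℤ × ℤ} (hn : 0 < n) (h : memQ1 n lam γ) :
    ∃ a c₁ c₂ : ℤ, 0 ≤ a ∧ a < n ∧ γ = a • lam + ((n : ℤ) * c₁, (n : ℤ) * c₂) := by
  obtain ⟨a, c₁, c₂, rfl⟩ := h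
  refine ⟨a % n, c₁ + a / n * lam.1, c₂ + a / n * lam.2, Int.emod_nonneg _ (by lia),
    Int.emod_lt_of_pos _ (by lia), ?_⟩
  have h := Int.emod_add_mul_ediv a n
  ext
  · simp only [Prod.fst_add, Prod.smul_fst, smul_eq_mul]
    linear_combination -lam.1 * h
  · simp only [Prod.snd_add, Prod.smul_snd, smul_eq_mul]
    linear_combination -lam.2 * h

/-- Proposition 4.6(d) core: (n,λ) ∈ {(5,(2,2)), (4,(3,2)), (4,(3,3))}. -/
theorem stmt11 (n : ℕ) (lam : ℤ × ℤ)
    (hcase : (n = 5 ∧ lam = (2, 2)) ∨ (n = 4 ∧ lam = (3, 2)) ∨ (n = 4 ∧ lam = (3, 3)))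
    (γ : ℤ × ℤ) (hγQ : memQ1 n lam γ) (hle : lam ≤ γ) (hne : γ ≠ lam)
    (hΓ : γ ∉ GammaQO n lam) :
    ∃ c₁ c₂ : ℤ, -1 ≤ c₁ ∧ -1 ≤ c₂ ∧ (c₁ = -1 ∨ c₂ = -1) ∧
      γ = ((n : ℤ) - 1) • lam + (n : ℤ) • ((c₁, c₂) : ℤ × ℤ) := by
  have hn : 0 < n := by lia
  obtain ⟨a, c₁, c₂, ha, han, rfl⟩ := hγQ.exists_coeff_lt hn
  have hneg : c₁ < 0 ∨ c₂ < 0 := by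
    by_contra! h
    exact hΓ (smul_add_mem_GammaQO n lam ha h.1 h.2)
  obtain ⟨h₁, h₂⟩ := Prod.le_def.mp hle
  rcases hcase with ⟨rfl, rfl⟩ | ⟨rfl, rfl⟩ | ⟨rfl, rfl⟩ <;>
  · simp only [Prod.fst_add, Prod.snd_add, Prod.smul_fst, Prod.smul_snd, smul_eq_mul,
      Nat.cast_ofNat] at h₁ h₂ han
    refine ⟨c₁, c₂, by lia, by lia, by lia, ?_⟩
    ext <;> simp <;> lia
end
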